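/- Let F be an algebraically closed field of characteristic 0 and let g be a finite-dimensional simple Lie algebra over F with dim g = 248 (type E8), equipped with a grading by (ℤ/5ℤ)^3 such that dim g_α = 2 for every nonzero α ∈ (ℤ/5ℤ)^3. Then for every nonzero α ∈ (ℤ/5ℤ)^3, the subspace g_{[α]} = g_α ⊕ g_{2α} ⊕ g_{3α} ⊕ g_{4α} is a Cartan subalgebra of g; moreover, if α and β are nonzero elements of (ℤ/5ℤ)^3 spanning different lines (i.e., β ∉ {α, 2α, 3α, 4α}), then g_{[α]} and g_{[β]} are orthogonal with respect to the Killing form of g. In particular, g decomposes as the direct sum of 31 pairwise Killing-orthogonal Cartan subalgebras, one for each point of the projective plane over ℤ/5ℤ. -/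

import Mathlib

open Module

/-- A grading of the Lie algebra `L` over `F` by the additive group `A`:
a direct sum decomposition into subspaces compatible with the bracket. -/
def IsLieGrading (F : Type*) {A L : Type*} [Field F] [AddCommGroup A] [DecidableEq A]
    [LieRing L] [LieAlgebra F L] (gr : A → Submodule F L) : Prop :=
  DirectSum.IsInternal gr ∧
    ∀ a b : A, ∀ x ∈ gr a, ∀ y ∈ gr b, ⁅x, y⁆ ∈ gr (a + b)


namespace RootPairing

variable {ι K M N : Type*} [Field K] [AddCommGroup M] [Module K M] [AddCommGroup N] [Module K N]
  (P : RootPairing ι K M N)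

/-- A set of roots of a root pairing is a *connected flat* if it consists of all roots in its linear
span, and it has no proper nonempty subset which is orthogonal to its complement. -/
def IsConnectedFlat (Ψ : Set ι) : Prop :=
  (∀ i, P.root i ∈ Submodule.span K (P.root '' Ψ) → i ∈ Ψ) ∧
    ∀ s ⊆ Ψ, (∀ i ∈ s, ∀ j ∈ Ψ \ s, P.pairing i j = 0) → s = ∅ ∨ s = Ψ

variable {P}

lemma coroot'_eq_zero_of_mem_span {s : Set ι} {j : ι} (h : ∀ i ∈ s, P.pairing i j = 0) {x : M}
    (hx : x ∈ Submodule.span K (P.root '' s)) : P.coroot' j x = 0 := by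
  have : Submodule.span K (P.root '' s) ≤ LinearMap.ker (P.coroot' j) := by
    rw [Submodule.span_le]
    rintro _ ⟨i, hi, rfl⟩
    simpa using h i hi
  exact this hx

lemma eq_empty_or_eq_of_subset_span_singleton [CharZero K] {i : ι} {Ψ s : Set ι}
    (hΨ : ∀ j ∈ Ψ, P.root j ∈ Submodule.span K {P.root i}) (hs : s ⊆ Ψ)
    (h : ∀ i ∈ s, ∀ j ∈ Ψ \ s, P.pairing i j = 0) : s = ∅ ∨ s = Ψ := by
  rcases s.eq_empty_or_nonempty with rfl | ⟨l, hl⟩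
  · exact .inl rfl
  refine .inr (hs.antisymm fun j hj ↦ ?_)
  by_contra hjs
  have h0 := h l hl j ⟨hj, hjs⟩
  obtain ⟨c, hc⟩ := Submodule.mem_span_singleton.mp (hΨ l (hs hl))
  obtain ⟨d, hd⟩ := Submodule.mem_span_singleton.mp (hΨ j hj)
  have hc0 : c ≠ 0 := by rintro rfl; exact P.ne_zero l (by simpa using hc.symm)
  rw [← root_coroot'_eq_pairing, ← hc, map_smul, smul_eq_mul, mul_eq_zero] at h0
  have h1 : P.coroot' j (P.root j) = 0 := by
    rw [← hd, map_smul, h0.resolve_left hc0, smul_zero]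
  simp at h1

lemma exists_isConnectedFlat_span_singleton [CharZero K] (i : ι) :
    ∃ Ψ : Set ι, P.IsConnectedFlat Ψ ∧
      Submodule.span K (P.root '' Ψ) = Submodule.span K {P.root i} ∧ i ∈ Ψ := by
  have hspan : Submodule.span K (P.root '' {j | P.root j ∈ Submodule.span K {P.root i}}) =
      Submodule.span K {P.root i} := by
    refine le_antisymm (Submodule.span_le.mpr ?_) (Submodule.span_mono ?_)
    · rintro _ ⟨j, hj, rfl⟩
      exact hj
    · rintro _ rfl
      exact ⟨i, Submodule.mem_span_singleton_self _, rfl⟩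
  exact ⟨{j | P.root j ∈ Submodule.span K {P.root i}}, ⟨fun j hj ↦ by rwa [hspan] at hj,
    fun s hs h ↦ eq_empty_or_eq_of_subset_span_singleton (fun j hj ↦ hj) hs h⟩, hspan,
    Submodule.mem_span_singleton_self _⟩

/-- Adjoining to a connected flat all the roots in the span of the flat and one further,
non-orthogonal, root gives a connected flat. -/
lemma IsConnectedFlat.adjoin [CharZero K] {Ψ : Set ι} (hΨ : P.IsConnectedFlat Ψ) {a b : ι}
    (hb : b ∈ Ψ) (hab : P.pairing a b ≠ 0) :
    P.IsConnectedFlat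
      {j | P.root j ∈ Submodule.span K (P.root '' Ψ) ⊔ Submodule.span K {P.root a}} := by
  set U := Submodule.span K (P.root '' Ψ)
  set U' := U ⊔ Submodule.span K {P.root a}
  have hΨU {j : ι} (hj : j ∈ Ψ) : P.root j ∈ U := Submodule.subset_span ⟨j, hj, rfl⟩
  have hΨ' {j : ι} (hj : j ∈ Ψ) : P.root j ∈ U' := Submodule.mem_sup_left (hΨU hj)
  have ha' : P.root a ∈ U' := Submodule.mem_sup_right (Submodule.mem_span_singleton_self _)
  have key (s : Set ι) (hs : s ⊆ {j | P.root j ∈ U'})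
      (h : ∀ i ∈ s, ∀ j ∈ {j | P.root j ∈ U'} \ s, P.pairing i j = 0) (hΨs : Ψ ⊆ s) :
      {j | P.root j ∈ U'} ⊆ s := by
    intro j hj
    by_contra hjs
    have has : a ∈ s := by
      by_contra has
      exact hab (pairing_eq_zero_iff'.mp (h b (hΨs hb) a ⟨ha', has⟩))
    have hU : U' ≤ LinearMap.ker (P.coroot' j) := by
      refine sup_le (Submodule.span_le.mpr ?_) (Submodule.span_le.mpr ?_)
      · rintro _ ⟨i, hi, rfl⟩
        simpa using h i (hΨs hi) j ⟨hj, hjs⟩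
      · rintro _ rfl
        simpa using h a has j ⟨hj, hjs⟩
    have := hU hj
    simp at this
  refine ⟨fun i hi ↦ ?_, fun s hs h ↦ ?_⟩
  · refine (Submodule.span_le.mpr ?_ : _ ≤ U') hi
    rintro _ ⟨j, hj, rfl⟩
    exact hj
  · rcases hΨ.2 (s ∩ Ψ) Set.inter_subset_right
      (fun i hi j hj ↦ h i hi.1 j ⟨hΨ' hj.1, fun hjs ↦ hj.2 ⟨hjs, hj.1⟩⟩) with hsΨ | hsΨ
    · left
      have := key ({j | P.root j ∈ U'} \ s) Set.sdiff_subset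
        (fun i hi j hj ↦ pairing_eq_zero_iff'.mp
          (h j (by by_contra hjs; exact hj.2 ⟨hj.1, hjs⟩) i hi))
        fun j hj ↦ ⟨hΨ' hj, fun hjs ↦ Set.notMem_empty j (hsΨ ▸ ⟨hjs, hj⟩)⟩
      rw [Set.eq_empty_iff_forall_notMem]
      exact fun j hj ↦ (this (hs hj)).2 hj
    · right
      exact hs.antisymm (key s hs h (Set.inter_eq_right.mp hsΨ))

/-- The affine translate of the span of a connected flat by a root outside the flat contains more
roots than the dimension of the span. -/
lemma IsConnectedFlat.finrank_lt_ncard [Finite ι] {Ψ : Set ι} (hΨ : P.IsConnectedFlat Ψ) {a b : ι}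
    (hb : b ∈ Ψ) (hab : P.pairing a b ≠ 0) :
    finrank K (Submodule.span K (P.root '' Ψ)) <
      {j | P.root j - P.root a ∈ Submodule.span K (P.root '' Ψ)}.ncard := by
  classical
  set U := Submodule.span K (P.root '' Ψ)
  set O : Set ι := {j | P.root j - P.root a ∈ U}
  set D := Submodule.span K ((fun j ↦ P.root j - P.root a) '' (O \ {a}))
  have hΨU {j : ι} (hj : j ∈ Ψ) : P.root j ∈ U := Submodule.subset_span ⟨j, hj, rfl⟩
  have hD {j : ι} (hj : j ∈ O) : P.root j - P.root a ∈ D := by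
    by_cases hja : j = a
    · simp [hja]
    · exact Submodule.subset_span ⟨j, ⟨hj, hja⟩, rfl⟩
  have haO : a ∈ O := by simp [O]
  have hor (i : ι) (hi : i ∈ Ψ) (hiD : P.root i ∉ D) (j : ι) (hj : j ∈ O) :
      P.pairing j i = 0 := by
    by_contra hji
    refine hiD ?_
    have hroot : P.root (P.reflectionPerm i j) - P.root a =
        (P.root j - P.root a) - P.pairing j i • P.root i := by
      rw [root_reflectionPerm, reflection_apply_root]
      abel
    have hmem : P.reflectionPerm i j ∈ O := by
      change P.root (P.reflectionPerm i j) - P.root a ∈ U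
      rw [hroot]
      exact U.sub_mem hj (U.smul_mem _ (hΨU hi))
    have h1 := D.sub_mem (hD hj) (hD hmem)
    rw [hroot, sub_sub_cancel] at h1
    exact (D.smul_mem_iff hji).mp h1
  have hUD : U ≤ D := by
    rcases hΨ.2 {i | i ∈ Ψ ∧ P.root i ∈ D} (fun i hi ↦ hi.1) (by
      rintro i ⟨hi, hiD⟩ j ⟨hj, hjs⟩
      have hjD : P.root j ∉ D := fun h ↦ hjs ⟨hj, h⟩
      have : D ≤ LinearMap.ker (P.coroot' j) := by
        refine Submodule.span_le.mpr ?_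
        rintro _ ⟨l, hl, rfl⟩
        simp [hor j hj hjD l hl.1, hor j hj hjD a haO]
      simpa using this hiD) with h | h
    · exact absurd (hor b hb (fun hbD ↦ Set.notMem_empty b (h ▸ ⟨hb, hbD⟩)) a haO) hab
    · refine Submodule.span_le.mpr ?_
      rintro _ ⟨j, hj, rfl⟩
      exact (h.symm ▸ hj : j ∈ {i | i ∈ Ψ ∧ P.root i ∈ D}).2
  have hfin : (O \ {a}).Finite := Set.toFinite _
  have hDcard : finrank K D ≤ (O \ {a}).ncard := by
    have := Fintype.ofFinite ((fun j ↦ P.root j - P.root a) '' (O \ {a}) : Set M)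
    refine (finrank_span_le_card _).trans ?_
    rw [← Set.ncard_eq_toFinset_card']
    exact Set.ncard_image_le hfin
  have : Module.Finite K D := Module.Finite.span_of_finite K (hfin.image _)
  have h1 := Set.ncard_sdiff_singleton_add_one haO (Set.toFinite O)
  have h2 := Submodule.finrank_mono hUD
  omega

lemma exists_isConnectedFlat [Finite ι] [CharZero K] [Module.Finite K M] [P.IsIrreducible]
    [Nonempty ι] {k : ℕ} (hk : 1 ≤ k) (hkM : k ≤ finrank K M) :
    ∃ Ψ : Set ι, P.IsConnectedFlat Ψ ∧ Ψ.Nonempty ∧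
      finrank K (Submodule.span K (P.root '' Ψ)) = k ∧ k * (k + 1) ≤ Ψ.ncard := by
  classical
  set n : ι → ι := fun i ↦ P.reflectionPerm i i
  have hn (i : ι) : P.root (n i) = -P.root i := by simp [n, root_reflectionPerm]
  have hninj : Function.Injective n := fun i j hij ↦ P.root.injective <| by
    simpa [hn] using congrArg P.root hij
  induction k, hk using Nat.le_induction with
  | base =>
    obtain ⟨i⟩ := ‹Nonempty ι›
    obtain ⟨Ψ, hΨ, hspan, hi⟩ := P.exists_isConnectedFlat_span_singleton i
    refine ⟨Ψ, hΨ, ⟨i, hi⟩, by rw [hspan, finrank_span_singleton (P.ne_zero i)], ?_⟩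
    have hni : n i ∈ Ψ := hΨ.1 _ <| by
      rw [hn, hspan]
      exact neg_mem (Submodule.mem_span_singleton_self _)
    have := IsAddTorsionFree.of_isTorsionFree K M
    have hne : i ≠ n i := fun h ↦ by
      have := congrArg P.root h
      rw [hn, self_eq_neg] at this
      exact P.ne_zero i this
    calc 1 * (1 + 1) = ({i, n i} : Set ι).ncard := (Set.ncard_pair hne).symm
      _ ≤ Ψ.ncard := Set.ncard_le_ncard (Set.insert_subset hi (Set.singleton_subset_iff.mpr hni))
  | succ k hk ih =>
    obtain ⟨Ψ, hΨ, hne, hfin, hcard⟩ := ih (by omega)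
    set U := Submodule.span K (P.root '' Ψ) with hU
    obtain ⟨a, haU, b, hb, hab⟩ : ∃ a, P.root a ∉ U ∧ ∃ b ∈ Ψ, P.pairing a b ≠ 0 := by
      by_contra! h
      have htop := P.span_root_image_eq_top_of_forall_orthogonal Ψ hne fun j hj i hi ↦
        isOrthogonal_iff_pairing_eq_zero.mpr (h j hj i hi)
      rw [← hU] at htop
      rw [htop, finrank_top] at hfin
      omega
    set U' := U ⊔ Submodule.span K {P.root a} with hU'
    have haU' : P.root a ∈ U' := Submodule.mem_sup_right (Submodule.mem_span_singleton_self _)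
    set O : Set ι := {j | P.root j - P.root a ∈ U} with hO
    have hOcard : k + 1 ≤ O.ncard := by
      have := hΨ.finrank_lt_ncard hb hab
      rw [← hU, hfin] at this
      exact this
    have hOU' {j : ι} (hj : j ∈ O) : P.root j ∈ U' := by
      rw [← sub_add_cancel (P.root j) (P.root a)]
      exact U'.add_mem (Submodule.mem_sup_left hj) haU'
    have hΨU {j : ι} (hj : j ∈ Ψ) : P.root j ∈ U := Submodule.subset_span ⟨j, hj, rfl⟩
    have hspan : Submodule.span K (P.root '' {j | P.root j ∈ U'}) = U' := by
      refine le_antisymm (Submodule.span_le.mpr ?_)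
        (sup_le (Submodule.span_mono (Set.image_mono fun j hj ↦ ?_)) (Submodule.span_mono ?_))
      · rintro _ ⟨j, hj, rfl⟩
        exact hj
      · exact Submodule.mem_sup_left (hΨU hj)
      · rintro _ rfl
        exact ⟨a, haU', rfl⟩
    refine ⟨{j | P.root j ∈ U'}, hΨ.adjoin hb hab, ⟨a, haU'⟩, ?_, ?_⟩
    · rw [hspan, hU', Submodule.finrank_sup_span_singleton haU, hfin]
    · have hd1 : Disjoint Ψ O := Set.disjoint_left.mpr fun j hj hjO ↦ haU <| by
        simpa using U.sub_mem (hΨU hj) hjO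
      have hd2 : Disjoint (Ψ ∪ O) (n '' O) := by
        refine Set.disjoint_left.mpr ?_
        rintro _ hj ⟨l, hl, rfl⟩
        rcases hj with hj | hj
        · refine haU ?_
          have h1 := hΨU hj
          rw [hn] at h1
          simpa using U.neg_mem (U.add_mem h1 hl)
        · have h1 : P.root (n l) - P.root a ∈ U := hj
          rw [hn] at h1
          have h2 : (-2 : K) • P.root a ∈ U := by
            convert U.add_mem h1 hl using 1
            module
          exact haU ((U.smul_mem_iff (by norm_num)).mp h2)
      calc (k + 1) * (k + 1 + 1) ≤ Ψ.ncard + O.ncard + O.ncard := by nlinarith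
        _ = (Ψ ∪ O ∪ n '' O).ncard := by
          rw [Set.ncard_union_eq hd2, Set.ncard_union_eq hd1, Set.ncard_image_of_injective _ hninj]
        _ ≤ _ := by
          refine Set.ncard_le_ncard (Set.union_subset (Set.union_subset ?_ ?_) ?_)
          · exact fun j hj ↦ Submodule.mem_sup_left (hΨU hj)
          · exact fun j hj ↦ hOU' hj
          · rintro _ ⟨j, hj, rfl⟩
            change P.root (n j) ∈ U'
            rw [hn]
            exact U'.neg_mem (hOU' hj)

/-- An irreducible root system of rank `r` has at least `r * (r + 1)` roots. -/
theorem finrank_mul_le_natCard [Finite ι] [CharZero K] [Module.Finite K M]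
    (P : RootPairing ι K M N) [P.IsRootSystem] [P.IsIrreducible] :
    finrank K M * (finrank K M + 1) ≤ Nat.card ι := by
  rcases Nat.eq_zero_or_pos (finrank K M) with h | h
  · simp [h]
  have hι : Nonempty ι := by
    by_contra hι
    rw [not_nonempty_iff] at hι
    have htop := IsRootSystem.span_root_eq_top (P := P)
    rw [Set.range_eq_empty, Submodule.span_empty] at htop
    rw [← finrank_top, ← htop, finrank_bot] at h
    exact h.false
  obtain ⟨Ψ, -, -, -, hcard⟩ := exists_isConnectedFlat (P := P) h le_rfl
  exact hcard.trans (Set.ncard_le_card Ψ)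

/-- A finite root system has an even number of roots. -/
theorem even_natCard [Finite ι] [CharZero K] (P : RootPairing ι K M N) : Even (Nat.card ι) := by
  classical
  have := Fintype.ofFinite ι
  let := P.indexNeg
  by_contra h
  rw [even_iff_two_dvd, Nat.card_eq_fintype_card] at h
  obtain ⟨i, hi⟩ := Equiv.Perm.exists_fixed_point_of_prime (p := 2) (n := 1) h (σ := Equiv.neg ι)
    (by ext i; rw [pow_one, pow_two]; exact neg_neg i)
  exact P.ne_neg i hi.symm

end RootPairing

namespace LieAlgebra.IsKilling

variable {K L : Type*} [Field K] [CharZero K] [LieRing L] [LieAlgebra K L] [FiniteDimensional K L]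
  [IsKilling K L]

section CartanSubalgebra

variable (H : LieSubalgebra K L) [H.IsCartanSubalgebra] [LieModule.IsTriangularizable K H L]

open LieModule in
lemma finrank_eq_finrank_add_natCard_root [Nontrivial H] :
    finrank K L = finrank K H + Nat.card H.root := by
  classical
  have hds := DirectSum.isInternal_submodule_of_iSupIndep_of_iSup_eq_top
    (LieSubmodule.iSupIndep_toSubmodule.mpr <| iSupIndep_genWeightSpace' K H L)
    (LieSubmodule.iSup_toSubmodule_eq_top.mpr <| iSup_genWeightSpace_eq_top' K H L)
  have hL : finrank K L = ∑ χ : Weight K H L, finrank K (genWeightSpace L χ) := by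
    rw [← (LinearEquiv.ofBijective (DirectSum.coeLinearMap _) hds).finrank_eq]
    exact finrank_directSum _ _
  have h0 : finrank K (genWeightSpace L ((0 : Weight K H L) : H → K)) = finrank K H := by
    change finrank K (rootSpace H (0 : H → K)) = _
    rw [rootSpace_zero_eq]
    rfl
  have h1 : (H.root : Finset (Weight K H L)) = Finset.univ.erase 0 := by
    ext χ
    simpa using Weight.isNonZero_iff_ne_zero
  rw [hL, ← Finset.add_sum_erase _ _ (Finset.mem_univ (0 : Weight K H L)), h0, ← h1,
    Finset.sum_congr rfl fun χ hχ ↦ finrank_rootSpace_eq_one χ (by simpa using hχ),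
    Finset.sum_const, smul_eq_mul, mul_one, Nat.card_eq_finsetCard]

/-- A simple Lie algebra of rank `r` has at least `r * (r + 1)` roots. -/
lemma finrank_mul_le_natCard_root [IsSimple K L] :
    finrank K H * (finrank K H + 1) ≤ Nat.card H.root := by
  have := (rootSystem H).finrank_mul_le_natCard
  rwa [Subspace.dual_finrank_eq] at this

end CartanSubalgebra

open Module.End in
/-- The abstract Jordan decomposition: the semisimple part of `ad x` is inner. -/
lemma exists_isSemisimple_isNilpotent_ad [IsAlgClosed K] (x : L) :
    ∃ s : L, (ad K L s).IsSemisimple ∧ Commute (ad K L x) (ad K L s) ∧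
      (∀ f : Module.End K L, Commute f (ad K L x) → Commute f (ad K L s)) ∧
      IsNilpotent (ad K L (x - s)) := by
  obtain ⟨N, -, S, hS₀, hN, hS, hSN⟩ := (ad K L x).exists_isNilpotent_isSemisimple
  have hcomm (f : Module.End K L) (hf : Commute f (ad K L x)) : Commute f S :=
    Algebra.commute_of_mem_adjoin_singleton_of_commute hS₀ hf
  replace hS₀ : Commute (ad K L x) S := Algebra.commute_of_mem_adjoin_self hS₀
  rw [eq_sub_of_add_eq hSN.symm] at hN
  have aux {μ : K} {y : L} (hy : y ∈ (ad K L x).maxGenEigenspace μ) : S y = μ • y := by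
    rw [maxGenEigenspace_eq] at hy
    rw [apply_eq_of_mem_of_comm_of_isFinitelySemisimple_of_isNil hy hS₀ hS.isFinitelySemisimple hN]
  have h_der (y z : L) (μ ν : K) (hy : y ∈ (ad K L x).maxGenEigenspace μ)
      (hz : z ∈ (ad K L x).maxGenEigenspace ν) : S ⁅y, z⁆ = ⁅S y, z⁆ + ⁅y, S z⁆ := by
    have hyz : ⁅y, z⁆ ∈ (ad K L x).maxGenEigenspace (μ + ν) :=
      LieModule.lie_mem_maxGenEigenspace_toEnd hy hz
    rw [aux hy, aux hz, aux hyz, smul_lie, lie_smul, ← add_smul]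
  replace h_der (y z : L) : S ⁅y, z⁆ = ⁅S y, z⁆ + ⁅y, S z⁆ := by
    have hy : y ∈ ⨆ μ : K, (ad K L x).maxGenEigenspace μ := by
      simp [iSup_maxGenEigenspace_eq_top]
    have hz : z ∈ ⨆ μ : K, (ad K L x).maxGenEigenspace μ := by
      simp [iSup_maxGenEigenspace_eq_top]
    induction hy using Submodule.iSup_induction' with
    | mem μ y hy =>
      induction hz using Submodule.iSup_induction' with
      | mem ν z hz => exact h_der y z μ ν hy hz
      | zero => simp
      | add _ _ _ _ h h' => simp only [lie_add, map_add, h, h']; abel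
    | zero => simp
    | add _ _ _ _ h h' => simp only [add_lie, map_add, h, h']; abel
  replace h_der : ∀ y z : L, S ⁅y, z⁆ = ⁅y, S z⁆ - ⁅z, S y⁆ := by
    simp_rw [← lie_skew (S _) _, add_comm, ← sub_eq_add_neg] at h_der; assumption
  obtain ⟨s, hs⟩ := LieDerivation.IsKilling.exists_eq_ad (⟨S, h_der⟩ : LieDerivation K L L)
  have hs : ad K L s = S := by rw [← LieDerivation.coe_ad_apply_eq_ad_apply s, hs]
  refine ⟨s, ?_, ?_, fun f hf ↦ ?_, ?_⟩
  · rwa [hs]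
  · rwa [hs]
  · rw [hs]; exact hcomm f hf
  · rw [map_sub, hs]
    exact hN

end LieAlgebra.IsKilling

namespace IsLieGrading

open LieAlgebra

variable {F A L : Type*} [Field F] [AddCommGroup A] [DecidableEq A] [LieRing L] [LieAlgebra F L]
  {gr : A → Submodule F L} (h : IsLieGrading F gr)

include h in
lemma isInternal : DirectSum.IsInternal gr :=
  h.1

include h in
lemma lie_mem {a b : A} {x y : L} (hx : x ∈ gr a) (hy : y ∈ gr b) : ⁅x, y⁆ ∈ gr (a + b) :=
  h.2 a b x hx y hy

include h in
lemma induction_on {p : L → Prop} (hgr : ∀ a, ∀ x ∈ gr a, p x)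
    (hadd : ∀ x y, p x → p y → p (x + y)) (x : L) : p x :=
  Submodule.iSup_induction gr (motive := p)
    (h.isInternal.submodule_iSup_eq_top ▸ Submodule.mem_top : x ∈ ⨆ a, gr a) hgr
    (hgr 0 0 (zero_mem _)) hadd

/-- The projection of a graded Lie algebra onto the component of degree `a`. -/
noncomputable def proj (a : A) : L →ₗ[F] L :=
  (gr a).subtype ∘ₗ DirectSum.component F A (fun a ↦ gr a) a ∘ₗ
    (LinearEquiv.ofBijective (DirectSum.coeLinearMap gr) h.isInternal).symm.toLinearMap

lemma proj_mem (a : A) (x : L) : h.proj a x ∈ gr a := by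
  simp [proj]

lemma proj_of_mem {a : A} {x : L} (hx : x ∈ gr a) (b : A) :
    h.proj b x = if a = b then x else 0 := by
  have : (LinearEquiv.ofBijective (DirectSum.coeLinearMap gr) h.isInternal).symm x =
      DirectSum.lof F A (fun a ↦ gr a) a ⟨x, hx⟩ := by
    rw [LinearEquiv.symm_apply_eq]
    exact (DirectSum.coeLinearMap_lof gr a ⟨x, hx⟩).symm
  simp only [proj, LinearMap.comp_apply, LinearEquiv.coe_coe, this]
  rw [DirectSum.component.of]
  split_ifs with hab
  · subst hab; rfl
  · rfl

lemma proj_same {a : A} {x : L} (hx : x ∈ gr a) : h.proj a x = x := by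
  simp [h.proj_of_mem hx]

lemma proj_ne {a b : A} {x : L} (hx : x ∈ gr a) (hab : a ≠ b) : h.proj b x = 0 := by
  simp [h.proj_of_mem hx, hab]

lemma sum_proj [Fintype A] (x : L) : ∑ a, h.proj a x = x := by
  induction x using h.induction_on with
  | hgr a x hx => simp [h.proj_of_mem hx]
  | hadd x y hx hy => simp [Finset.sum_add_distrib, hx, hy]

lemma proj_lie_of_mem_left {a : A} {x : L} (hx : x ∈ gr a) (b : A) (y : L) :
    h.proj (a + b) ⁅x, y⁆ = ⁅x, h.proj b y⁆ := by
  induction y using h.induction_on with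
  | hgr c y hy =>
    rw [h.proj_of_mem hy, h.proj_of_mem (h.lie_mem hx hy)]
    simp only [add_right_inj]
    split_ifs <;> simp
  | hadd y z hy hz => simp [hy, hz]

lemma proj_lie_of_mem_right {b : A} {y : L} (hy : y ∈ gr b) (a : A) (x : L) :
    h.proj (a + b) ⁅x, y⁆ = ⁅h.proj a x, y⁆ := by
  rw [← lie_skew, map_neg, add_comm, h.proj_lie_of_mem_left hy, lie_skew]

lemma ad_pow_proj {a : A} {x : L} (hx : x ∈ gr a) (b : A) (k : ℕ) (v : L) :
    (ad F L x ^ k) (h.proj b v) = h.proj (k • a + b) ((ad F L x ^ k) v) := by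
  induction k with
  | zero => simp
  | succ k ih =>
    rw [pow_succ', Module.End.mul_apply, Module.End.mul_apply, ih, ad_apply, ad_apply,
      ← h.proj_lie_of_mem_left hx, succ_nsmul', add_assoc]

include h in
lemma ad_pow_mem {a b : A} {x y : L} (hx : x ∈ gr a) (hy : y ∈ gr b) (k : ℕ) :
    (ad F L x ^ k) y ∈ gr (k • a + b) := by
  rw [← h.proj_same hy, h.ad_pow_proj hx]
  exact h.proj_mem _ _

include h in
lemma killingForm_eq_zero [Fintype A] [FiniteDimensional F L] {a b : A} (hab : a + b ≠ 0) {x y : L}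
    (hx : x ∈ gr a) (hy : y ∈ gr b) : killingForm F L x y = 0 := by
  rw [killingForm_apply_apply]
  refine LinearMap.trace_eq_zero_of_mapsTo_ne h.isInternal (fun i ↦ a + b + i) (fun i ↦ by simpa) ?_
  intro i z hz
  rw [add_assoc]
  exact h.lie_mem hx (h.lie_mem hy hz)

lemma killingForm_proj_of_mem_neg [Fintype A] [FiniteDimensional F L] {a : A} {y : L}
    (hy : y ∈ gr (-a)) (x : L) : killingForm F L (h.proj a x) y = killingForm F L x y := by
  induction x using h.induction_on with
  | hgr c x hx =>
    by_cases hac : c = a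
    · subst hac
      rw [h.proj_same hx]
    · rw [h.proj_ne hx hac, map_zero, LinearMap.zero_apply, h.killingForm_eq_zero _ hx hy]
      rwa [← sub_eq_add_neg, sub_ne_zero]
  | hadd x z hx hz => simp [hx, hz]

section IsKilling

variable [Fintype A] [FiniteDimensional F L] [IsKilling F L] [IsAlgClosed F] [CharZero F]

include h in
lemma lie_eq_zero_of_mem_of_ad_pow_eq_zero (h0 : gr 0 = ⊥) {a b : A} {x v : L}
    (hx : x ∈ gr a) (hv : v ∈ gr b) {k : ℕ} (hk : (ad F L x ^ k) v = 0) : ⁅x, v⁆ = 0 := by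
  obtain ⟨s, hs, hxs, hcomm, hn⟩ := IsKilling.exists_isSemisimple_isNilpotent_ad (K := F) x
  have hzero : h.proj a (x - s) = 0 := by
    refine IsKilling.killingForm_nondegenerate F L |>.1 _ fun y ↦ ?_
    induction y using h.induction_on with
    | hgr c y hy =>
      by_cases hac : a + c = 0
      · obtain rfl : c = -a := (neg_eq_of_add_eq_zero_right hac).symm
        have hxy : ⁅x, y⁆ = 0 := by
          have := h.lie_mem hx hy
          rwa [hac, h0, Submodule.mem_bot] at this
        have hyx : Commute (ad F L y) (ad F L x) := by
          ext z
          rw [Module.End.mul_apply, Module.End.mul_apply, ad_apply, ad_apply, ad_apply, ad_apply,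
            leibniz_lie, ← lie_skew y x, hxy, neg_zero, zero_lie, zero_add]
        have hny : Commute (ad F L (x - s)) (ad F L y) := by
          rw [map_sub]
          exact (hyx.sub_right (hcomm _ hyx)).symm
        rw [h.killingForm_proj_of_mem_neg hy, killingForm_apply_apply]
        exact (LinearMap.isNilpotent_trace_of_isNilpotent (hny.isNilpotent_mul_right hn)).eq_zero
      · exact h.killingForm_eq_zero hac (h.proj_mem _ _) hy
    | hadd y z hy hz => rw [map_add, hy, hz, add_zero]
  have hsv : ⁅s, v⁆ = 0 := by
    have hv' : v ∈ (ad F L x).genEigenspace 0 k := by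
      rw [Module.End.mem_genEigenspace_nat]
      simpa using hk
    have := Module.End.apply_eq_of_mem_of_comm_of_isFinitelySemisimple_of_isNil hv' hxs
      hs.isFinitelySemisimple (by rwa [← map_sub])
    simpa using this
  calc ⁅x, v⁆ = h.proj (a + b) ⁅x - s, v⁆ := by
        rw [sub_lie, hsv, sub_zero, h.proj_same (h.lie_mem hx hv)]
    _ = 0 := by rw [h.proj_lie_of_mem_right hv, hzero, zero_lie]

include h in
/-- If the component of degree zero of a graded Killing Lie algebra is trivial, then homogeneous
elements are semisimple, in the sense that they do not have generalized null vectors apart from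
the obvious ones. -/
lemma lie_eq_zero_of_ad_pow_eq_zero (h0 : gr 0 = ⊥) {a : A} {x v : L} (hx : x ∈ gr a) {k : ℕ}
    (hk : (ad F L x ^ k) v = 0) : ⁅x, v⁆ = 0 := by
  rw [← h.sum_proj v, lie_sum]
  refine Finset.sum_eq_zero fun b _ ↦ ?_
  refine h.lie_eq_zero_of_mem_of_ad_pow_eq_zero h0 hx (h.proj_mem b v) (k := k) ?_
  rw [h.ad_pow_proj hx, hk, map_zero]

include h in
lemma lie_eq_zero_of_mem_nsmul (h0 : gr 0 = ⊥) {a : A} {m k : ℕ} (hm : (m + k) • a = 0) {x y : L}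
    (hx : x ∈ gr a) (hy : y ∈ gr (k • a)) : ⁅x, y⁆ = 0 := by
  refine h.lie_eq_zero_of_ad_pow_eq_zero h0 hx (k := m) ?_
  have := h.ad_pow_mem hx hy m
  rwa [← add_nsmul, hm, h0, Submodule.mem_bot] at this

end IsKilling

/-- A subspace of a graded Lie algebra is graded if it contains the homogeneous components of all
its elements. -/
def IsGraded (W : Submodule F L) : Prop :=
  ∀ a, ∀ x ∈ W, h.proj a x ∈ W

variable {h} in
lemma IsGraded.inf {V W : Submodule F L} (hV : h.IsGraded V) (hW : h.IsGraded W) :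
    h.IsGraded (V ⊓ W) :=
  fun a x hx ↦ ⟨hV a x hx.1, hW a x hx.2⟩

variable {h} in
lemma IsGraded.sup {V W : Submodule F L} (hV : h.IsGraded V) (hW : h.IsGraded W) :
    h.IsGraded (V ⊔ W) := by
  intro a x hx
  obtain ⟨v, hv, w, hw, rfl⟩ := Submodule.mem_sup.mp hx
  rw [map_add]
  exact Submodule.add_mem_sup (hV a v hv) (hW a w hw)

variable {h} in
lemma IsGraded.iSup {ι : Type*} {W : ι → Submodule F L} (hW : ∀ i, h.IsGraded (W i)) :
    h.IsGraded (⨆ i, W i) := fun a _ hx ↦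
  (iSup_le fun i w hw ↦ Submodule.mem_iSup_of_mem i (hW i a w hw) :
    ⨆ i, W i ≤ (⨆ i, W i).comap (h.proj a)) hx

lemma isGraded_component (a : A) : h.IsGraded (gr a) := by
  intro b x hx
  rw [h.proj_of_mem hx]
  split_ifs
  · exact hx
  · exact zero_mem _

lemma isGraded_span_singleton {a : A} {x : L} (hx : x ∈ gr a) :
    h.IsGraded (Submodule.span F {x}) := by
  intro b y hy
  obtain ⟨c, rfl⟩ := Submodule.mem_span_singleton.mp hy
  rw [h.proj_of_mem (Submodule.smul_mem _ c hx)]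
  split_ifs
  · exact hy
  · exact zero_mem _

lemma isGraded_ker_ad {a : A} {x : L} (hx : x ∈ gr a) :
    h.IsGraded (LinearMap.ker (ad F L x)) := by
  intro b y hy
  rw [LinearMap.mem_ker, ad_apply] at hy ⊢
  rw [← h.proj_lie_of_mem_left hx, hy, map_zero]

variable {h} in
lemma IsGraded.map_ad {W : Submodule F L} (hW : h.IsGraded W) {a : A} {x : L} (hx : x ∈ gr a) :
    h.IsGraded (W.map (ad F L x)) := by
  rintro b _ ⟨y, hy, rfl⟩
  refine ⟨h.proj (b - a) y, hW _ y hy, ?_⟩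
  rw [ad_apply, ad_apply, ← h.proj_lie_of_mem_left hx, add_sub_cancel]

variable {h} in
lemma IsGraded.finrank_eq_sum [Fintype A] [FiniteDimensional F L] {W : Submodule F L}
    (hW : h.IsGraded W) : finrank F W = ∑ a, finrank F ↥(W ⊓ gr a) := by
  let f : W →ₗ[F] ∀ a, ↥(W ⊓ gr a) := LinearMap.pi fun a ↦
    (h.proj a).restrict fun x hx ↦ ⟨hW a x hx, h.proj_mem a x⟩
  have hf (w : W) (a : A) : (f w a : L) = h.proj a w := rfl
  have hf : Function.Bijective f := by
    refine ⟨(injective_iff_map_eq_zero f).mpr fun w hw ↦ ?_, fun v ↦ ?_⟩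
    · rw [← Submodule.coe_eq_zero, ← h.sum_proj w]
      exact Finset.sum_eq_zero fun a _ ↦ by rw [← hf, hw]; rfl
    · refine ⟨⟨∑ a, (v a : L), sum_mem fun a _ ↦ (v a).2.1⟩, ?_⟩
      ext a
      rw [hf, map_sum, Finset.sum_congr rfl fun b _ ↦ h.proj_of_mem (v b).2.2 a]
      simp
  rw [(LinearEquiv.ofBijective f hf).finrank_eq, finrank_pi_fintype]

/-- If a homogeneous element of nonzero degree acts injectively on a graded subspace of a Lie
algebra graded by an elementary abelian `p`-group, then the dimension of the subspace is divisible
by `p`. -/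
lemma IsGraded.dvd_finrank [Fintype A] [FiniteDimensional F L] {p : ℕ} [Fact p.Prime]
    [Module (ZMod p) A] {W : Submodule F L} (hW : h.IsGraded W) {a : A} (ha : a ≠ 0) {x : L}
    (hx : x ∈ gr a) (hmaps : ∀ w ∈ W, ⁅x, w⁆ ∈ W) (hinj : ∀ w ∈ W, ⁅x, w⁆ = 0 → w = 0) :
    p ∣ finrank F W := by
  let d (b : A) : ℕ := finrank F ↥(W ⊓ gr b)
  have hle (b : A) : d b ≤ d (a + b) := by
    let f : ↥(W ⊓ gr b) →ₗ[F] ↥(W ⊓ gr (a + b)) :=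
      (ad F L x).restrict fun w hw ↦ ⟨hmaps w hw.1, h.lie_mem hx hw.2⟩
    refine LinearMap.finrank_le_finrank_of_injective (f := f)
      ((injective_iff_map_eq_zero f).mpr fun w hw ↦ Subtype.ext (hinj w w.2.1 ?_))
    exact congrArg Subtype.val hw
  have heq : ∀ b, d b = d (a + b) := by
    have hsum : ∑ b, d b = ∑ b, d (a + b) := (Equiv.sum_comp (Equiv.addLeft a) d).symm
    simpa using (Finset.sum_eq_sum_iff_of_le fun b _ ↦ hle b).mp hsum
  obtain ⟨φ, hφ⟩ := Projective.exists_dual_ne_zero (ZMod p) ha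
  have hφsum : ∑ b, (d b : ZMod p) * φ b = ∑ b, (d b : ZMod p) * φ b + φ a * ∑ b, (d b : ZMod p) :=
    calc ∑ b, (d b : ZMod p) * φ b = ∑ b, (d (a + b) : ZMod p) * φ (a + b) :=
          (Equiv.sum_comp (Equiv.addLeft a) fun b ↦ (d b : ZMod p) * φ b).symm
      _ = ∑ b, ((d b : ZMod p) * φ b + φ a * d b) :=
          Finset.sum_congr rfl fun b _ ↦ by rw [← heq, map_add]; ring
      _ = _ := by rw [Finset.sum_add_distrib, Finset.mul_sum]
  rw [left_eq_add, mul_eq_zero] at hφsum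
  rw [← ZMod.natCast_eq_zero_iff, hW.finrank_eq_sum, Nat.cast_sum]
  exact hφsum.resolve_left hφ

section Toral

variable {T : Submodule F L}

include h in
/-- A maximal graded abelian subspace is its own centralizer. -/
lemma exists_isGraded_centralizer_eq [Fintype A] [FiniteDimensional F L] {W : Submodule F L}
    (hW : h.IsGraded W) (hcomm : ∀ x ∈ W, ∀ y ∈ W, ⁅x, y⁆ = 0) :
    ∃ T : Submodule F L, W ≤ T ∧ h.IsGraded T ∧ (∀ x ∈ T, ∀ y ∈ T, ⁅x, y⁆ = 0) ∧
      ∀ x, (∀ t ∈ T, ⁅t, x⁆ = 0) → x ∈ T := by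
  obtain ⟨T, hWT, hT⟩ := exists_maximal_ge_of_wellFoundedGT
    (fun T : Submodule F L ↦ h.IsGraded T ∧ ∀ x ∈ T, ∀ y ∈ T, ⁅x, y⁆ = 0) W ⟨hW, hcomm⟩
  refine ⟨T, hWT, hT.prop.1, hT.prop.2, fun x hx ↦ ?_⟩
  rw [← h.sum_proj x]
  refine sum_mem fun a _ ↦ ?_
  have hx' (t : L) (ht : t ∈ T) : ⁅t, h.proj a x⁆ = 0 := by
    rw [← h.sum_proj t, sum_lie]
    refine Finset.sum_eq_zero fun b _ ↦ ?_
    rw [← h.proj_lie_of_mem_left (h.proj_mem b t), hx _ (hT.prop.1 b t ht), map_zero]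
  have hle : T ⊔ Submodule.span F {h.proj a x} ≤ T := by
    refine hT.le_of_ge ⟨hT.prop.1.sup (h.isGraded_span_singleton (h.proj_mem a x)), ?_⟩ le_sup_left
    intro y hy z hz
    obtain ⟨t, ht, _, hc, rfl⟩ := Submodule.mem_sup.mp hy
    obtain ⟨c, rfl⟩ := Submodule.mem_span_singleton.mp hc
    obtain ⟨u, hu, _, hd, rfl⟩ := Submodule.mem_sup.mp hz
    obtain ⟨d, rfl⟩ := Submodule.mem_span_singleton.mp hd
    have hux : ⁅h.proj a x, u⁆ = 0 := by rw [← lie_skew, hx' u hu, neg_zero]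
    simp [hT.prop.2 t ht u hu, hx' t ht, hux]
  exact hle (Submodule.mem_sup_right (Submodule.mem_span_singleton_self _))

variable [Fintype A] [FiniteDimensional F L] [IsKilling F L] [IsAlgClosed F] [CharZero F]

variable {h} in
lemma isCartanSubalgebra_of_isGraded (h0 : gr 0 = ⊥) {H : LieSubalgebra F L}
    (hH : h.IsGraded H.toSubmodule) (hcomm : ∀ x ∈ H, ∀ y ∈ H, ⁅x, y⁆ = 0)
    (hcent : ∀ x, (∀ t ∈ H, ⁅t, x⁆ = 0) → x ∈ H) : H.IsCartanSubalgebra where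
  nilpotent := by
    have : IsLieAbelian H := ⟨fun x y ↦ Subtype.ext (hcomm x x.2 y y.2)⟩
    infer_instance
  self_normalizing := by
    refine le_antisymm (fun x hx ↦ hcent x fun t ht ↦ ?_) H.le_normalizer
    rw [LieSubalgebra.mem_normalizer_iff'] at hx
    rw [← h.sum_proj t, sum_lie]
    refine Finset.sum_eq_zero fun b _ ↦ ?_
    have hb := hH b t ht
    refine h.lie_eq_zero_of_ad_pow_eq_zero h0 (h.proj_mem b t) (k := 2) ?_
    rw [pow_two, Module.End.mul_apply, ad_apply, ad_apply]
    exact hcomm _ hb _ (hx _ hb)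

variable {p : ℕ} [Fact p.Prime] [Module (ZMod p) A]

variable {h} in
/-- The dimension of a graded subspace stable under a graded abelian subalgebra is congruent
modulo `p` to the dimension of the space of invariants. -/
lemma IsGraded.finrank_modEq (h0 : gr 0 = ⊥) (hT : h.IsGraded T)
    (hcomm : ∀ x ∈ T, ∀ y ∈ T, ⁅x, y⁆ = 0) {W : Submodule F L} (hW : h.IsGraded W)
    (hTW : ∀ t ∈ T, ∀ w ∈ W, ⁅t, w⁆ ∈ W) :
    finrank F W ≡ finrank F ↥(W ⊓ ⨅ t : T, LinearMap.ker (ad F L (t : L))) [MOD p] := by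
  induction hn : finrank F W using Nat.strong_induction_on generalizing W with | _ n ih
  subst hn
  by_cases htriv : ∀ a, ∀ t ∈ T, t ∈ gr a → ∀ w ∈ W, ⁅t, w⁆ = 0
  · rw [inf_of_le_left]
    intro w hw
    simp only [Submodule.mem_iInf, LinearMap.mem_ker, ad_apply, Subtype.forall]
    intro t ht
    rw [← h.sum_proj t, sum_lie]
    exact Finset.sum_eq_zero fun b _ ↦ htriv b _ (hT b t ht) (h.proj_mem b t) w hw
  push Not at htriv
  obtain ⟨a, t, ht, hta, w, hw, htw⟩ := htriv
  have ha : a ≠ 0 := by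
    rintro rfl
    rw [h0, Submodule.mem_bot] at hta
    simp [hta] at htw
  have hlt : W ⊓ LinearMap.ker (ad F L t) < W :=
    inf_le_left.lt_of_ne fun heq ↦ htw (by simpa using (heq.ge hw).2)
  have hK := ih _ (Submodule.finrank_lt_finrank_of_lt hlt) (hW.inf (h.isGraded_ker_ad hta))
    (fun s hs v hv ↦ ⟨hTW s hs v hv.1, by
      have hv2 : ⁅t, v⁆ = 0 := by simpa using hv.2
      rw [SetLike.mem_coe, LinearMap.mem_ker, ad_apply, leibniz_lie, hcomm t ht s hs, hv2, zero_lie,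
        lie_zero, add_zero]⟩) rfl
  have hinf : W ⊓ LinearMap.ker (ad F L t) ⊓ ⨅ t : T, LinearMap.ker (ad F L (t : L)) =
      W ⊓ ⨅ t : T, LinearMap.ker (ad F L (t : L)) := by
    rw [inf_assoc]
    congr 1
    exact inf_of_le_right (iInf_le (fun t : T ↦ LinearMap.ker (ad F L (t : L))) ⟨t, ht⟩)
  rw [hinf] at hK
  have hR : p ∣ finrank F (W.map (ad F L t)) := by
    refine IsGraded.dvd_finrank h (hW.map_ad hta) ha hta ?_ ?_
    · rintro _ ⟨v, hv, rfl⟩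
      exact ⟨_, hTW t ht v hv, rfl⟩
    · rintro _ ⟨v, hv, rfl⟩ h2
      exact h.lie_eq_zero_of_ad_pow_eq_zero h0 hta (k := 2) (by simpa [pow_two] using h2)
  have hadd : finrank F (W.map (ad F L t)) + finrank F ↥(W ⊓ LinearMap.ker (ad F L t)) =
      finrank F W := by
    rw [← LinearMap.finrank_range_add_finrank_ker ((ad F L t).domRestrict W),
      LinearMap.range_domRestrict, LinearMap.ker_domRestrict, ← Submodule.map_comap_subtype,
      Submodule.finrank_map_subtype_eq]
  refine Nat.ModEq.trans ?_ hK
  rw [← hadd]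
  exact ((Nat.modEq_zero_iff_dvd.mpr hR).add_right _).trans (by rw [zero_add])

include h in
lemma lie_eq_zero_of_mem_iSup_smul (h0 : gr 0 = ⊥) (a : A) {x y : L}
    (hx : x ∈ ⨆ c : ZMod p, gr (c • a)) (hy : y ∈ ⨆ c : ZMod p, gr (c • a)) : ⁅x, y⁆ = 0 := by
  induction hx using Submodule.iSup_induction' with
  | mem c x hx =>
    induction hy using Submodule.iSup_induction' with
    | mem d y hy =>
      rcases eq_or_ne c 0 with rfl | hc
      · rw [zero_smul, h0, Submodule.mem_bot] at hx
        rw [hx, zero_lie]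
      obtain ⟨k, hk⟩ : ∃ k : ℕ, d • a = k • c • a :=
        ⟨(d * c⁻¹).val, by
          rw [← Nat.cast_smul_eq_nsmul (ZMod p), ZMod.natCast_zmod_val, smul_smul,
            inv_mul_cancel_right₀ hc]⟩
      rw [hk] at hy
      refine h.lie_eq_zero_of_mem_nsmul h0 (m := (p - 1) * k) ?_ hx hy
      rw [← Nat.cast_smul_eq_nsmul (ZMod p), ← Nat.succ_mul, Nat.succ_eq_add_one,
        Nat.sub_add_cancel (Fact.out : p.Prime).one_le]
      simp
    | zero => simp
    | add y z _ _ hy hz => simp [hy, hz]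
  | zero => simp
  | add x z _ _ hx hz => simp [hx, hz]

omit [IsKilling F L] [IsAlgClosed F] [CharZero F] in
include h in
lemma killingForm_eq_zero_of_mem_iSup_smul (h0 : gr 0 = ⊥) {a b : A}
    (hab : ∀ c : ZMod p, b ≠ c • a) {x y : L}
    (hx : x ∈ ⨆ c : ZMod p, gr (c • a)) (hy : y ∈ ⨆ c : ZMod p, gr (c • b)) :
    killingForm F L x y = 0 := by
  induction hx using Submodule.iSup_induction' with
  | mem c x hx =>
    induction hy using Submodule.iSup_induction' with
    | mem d y hy =>
      rcases eq_or_ne d 0 with rfl | hd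
      · rw [zero_smul, h0, Submodule.mem_bot] at hy
        rw [hy, map_zero]
      refine h.killingForm_eq_zero (fun hcd ↦ hab (d⁻¹ * -c) ?_) hx hy
      rw [mul_smul, neg_smul, neg_eq_of_add_eq_zero_right hcd, inv_smul_smul₀ hd]
    | zero => simp
    | add y z _ _ hy hz => simp [hy, hz]
  | zero => simp
  | add x z _ _ hx hz => simp [hx, hz]

omit [IsKilling F L] [IsAlgClosed F] [CharZero F] in
include h in
lemma le_finrank_iSup_smul {m : ℕ} (hm : ∀ a ≠ 0, finrank F (gr a) = m) {a : A} (ha : a ≠ 0) :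
    (p - 1) * m ≤ finrank F ↥(⨆ c : ZMod p, gr (c • a)) := by
  have hW : h.IsGraded (⨆ c : ZMod p, gr (c • a)) := .iSup fun c ↦ h.isGraded_component _
  calc (p - 1) * m = ∑ c ∈ (Finset.univ.erase 0 : Finset (ZMod p)), finrank F (gr (c • a)) := by
        rw [Finset.sum_congr rfl fun c hc ↦ hm _ (smul_ne_zero (Finset.ne_of_mem_erase hc) ha)]
        simp [Finset.card_erase_of_mem, ZMod.card]
    _ = ∑ c ∈ (Finset.univ.erase 0 : Finset (ZMod p)),
          finrank F ↥((⨆ c : ZMod p, gr (c • a)) ⊓ gr (c • a)) :=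
        Finset.sum_congr rfl fun c _ ↦ by
          rw [inf_of_le_right (le_iSup (fun c : ZMod p ↦ gr (c • a)) c)]
    _ = ∑ b ∈ (Finset.univ.erase 0 : Finset (ZMod p)).image (· • a),
          finrank F ↥((⨆ c : ZMod p, gr (c • a)) ⊓ gr b) :=
        (Finset.sum_image (f := fun b ↦ finrank F ↥((⨆ c : ZMod p, gr (c • a)) ⊓ gr b))
          (smul_left_injective (ZMod p) ha).injOn).symm
    _ ≤ ∑ b, finrank F ↥((⨆ c : ZMod p, gr (c • a)) ⊓ gr b) :=
        Finset.sum_le_sum_of_subset (Finset.subset_univ _)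
    _ = _ := hW.finrank_eq_sum.symm

include h in
/-- Every graded abelian subspace is contained in a graded Cartan subalgebra, whose rank is
congruent modulo `p` to the dimension of the whole algebra. -/
lemma exists_isCartanSubalgebra (h0 : gr 0 = ⊥) {W : Submodule F L}
    (hW : h.IsGraded W) (hcomm : ∀ x ∈ W, ∀ y ∈ W, ⁅x, y⁆ = 0) :
    ∃ H : LieSubalgebra F L, W ≤ H.toSubmodule ∧ H.IsCartanSubalgebra ∧
      finrank F L ≡ finrank F H [MOD p] := by
  obtain ⟨T, hWT, hT, hTcomm, hTcent⟩ := h.exists_isGraded_centralizer_eq hW hcomm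
  have hlie {x y : L} (hx : x ∈ T.carrier) (hy : y ∈ T.carrier) : ⁅x, y⁆ ∈ T.carrier := by
    rw [hTcomm x hx y hy]
    exact T.zero_mem
  refine ⟨{ T with lie_mem' := hlie }, hWT,
    isCartanSubalgebra_of_isGraded h0 hT hTcomm hTcent, ?_⟩
  have hmod := IsGraded.finrank_modEq (p := p) h0 hT hTcomm (W := ⊤) (fun _ _ _ ↦ trivial)
    fun _ _ _ _ ↦ trivial
  have hcent : ⊤ ⊓ ⨅ t : T, LinearMap.ker (ad F L (t : L)) = T := by
    ext x
    simpa using ⟨hTcent x, fun hx t ht ↦ hTcomm t ht x hx⟩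
  rwa [finrank_top, hcent] at hmod

end Toral

end IsLieGrading

theorem orthogonal_decomposition_E8_Z5
    (F : Type*) [Field F] [IsAlgClosed F] [CharZero F]
    (L : Type*) [LieRing L] [LieAlgebra F L] [FiniteDimensional F L]
    [LieAlgebra.IsSimple F L] (hdim : finrank F L = 248)
    (gr : (Fin 3 → ZMod 5) → Submodule F L) (hgr : IsLieGrading F gr)
    (hdims : ∀ a : Fin 3 → ZMod 5, a ≠ 0 → finrank F (gr a) = 2) :
    (∀ α : Fin 3 → ZMod 5, α ≠ 0 →
      ∃ H : LieSubalgebra F L,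
        H.toSubmodule = gr α ⊔ gr (2 • α) ⊔ gr (3 • α) ⊔ gr (4 • α) ∧
        H.IsCartanSubalgebra) ∧
    (∀ α β : Fin 3 → ZMod 5, α ≠ 0 → β ≠ 0 →
      β ≠ α → β ≠ 2 • α → β ≠ 3 • α → β ≠ 4 • α →
      ∀ x ∈ gr α ⊔ gr (2 • α) ⊔ gr (3 • α) ⊔ gr (4 • α),
      ∀ y ∈ gr β ⊔ gr (2 • β) ⊔ gr (3 • β) ⊔ gr (4 • β),
      killingForm F L x y = 0) := by
  have : Fact (Nat.Prime 5) := ⟨by norm_num⟩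
  have h0 : gr 0 = ⊥ := by
    have hfull : hgr.IsGraded ⊤ := fun _ _ _ ↦ trivial
    have hsum : finrank F L = ∑ a, finrank F (gr a) := by
      rw [← finrank_top, hfull.finrank_eq_sum]
      exact Finset.sum_congr rfl fun a _ ↦ by rw [top_inf_eq]
    rw [hdim, ← Finset.add_sum_erase _ _ (Finset.mem_univ 0),
      Finset.sum_congr rfl fun a ha ↦ hdims a (Finset.ne_of_mem_erase ha), Finset.sum_const,
      Finset.card_erase_of_mem (Finset.mem_univ _), Finset.card_univ, Fintype.card_pi,
      Fin.prod_univ_three, ZMod.card] at hsum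
    rw [← Submodule.finrank_eq_zero (R := F)]
    simpa using hsum
  have hline (α : Fin 3 → ZMod 5) : gr α ⊔ gr (2 • α) ⊔ gr (3 • α) ⊔ gr (4 • α) =
      ⨆ c : ZMod 5, gr (c • α) := by
    have hcast (n : ℕ) : gr (n • α) ≤ ⨆ c : ZMod 5, gr (c • α) := by
      rw [← Nat.cast_smul_eq_nsmul (ZMod 5)]
      exact le_iSup (fun c : ZMod 5 ↦ gr (c • α)) n
    refine le_antisymm (sup_le (sup_le (sup_le ?_ (hcast 2)) (hcast 3)) (hcast 4))
      (iSup_le fun c ↦ ?_)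
    · simpa using hcast 1
    · have hc : c • α = c.val • α := by
        rw [← Nat.cast_smul_eq_nsmul (ZMod 5), ZMod.natCast_zmod_val]
      have hlt := c.val_lt
      rw [hc]
      interval_cases c.val
      · simp [h0]
      · rw [one_smul]
        exact le_sup_of_le_left (le_sup_of_le_left le_sup_left)
      · exact le_sup_of_le_left (le_sup_of_le_left le_sup_right)
      · exact le_sup_of_le_left le_sup_right
      · exact le_sup_right
  refine ⟨fun α hα ↦ ?_, fun α β hα hβ h1 h2 h3 h4 x hx y hy ↦ ?_⟩
  · obtain ⟨H, hle, hH, hmod⟩ := hgr.exists_isCartanSubalgebra (p := 5) h0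
      (.iSup fun c : ZMod 5 ↦ hgr.isGraded_component (c • α))
      fun x hx y hy ↦ hgr.lie_eq_zero_of_mem_iSup_smul h0 α hx hy
    refine ⟨H, ?_, hH⟩
    rw [hline]
    have h8 := hgr.le_finrank_iSup_smul (p := 5) hdims hα
    have hge : 8 ≤ finrank F H := h8.trans (Submodule.finrank_mono hle)
    have : Nontrivial H := Module.nontrivial_of_finrank_pos (R := F) (by omega)
    have hroot := LieAlgebra.IsKilling.finrank_eq_finrank_add_natCard_root (K := F) H
    have hbound := LieAlgebra.IsKilling.finrank_mul_le_natCard_root (K := F) H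
    obtain ⟨m, hm⟩ := (LieAlgebra.IsKilling.rootSystem (K := F) H).even_natCard
    have hr : finrank F H = 8 := by
      rw [hdim] at hmod hroot
      have hlt : finrank F H < 16 := by nlinarith
      unfold Nat.ModEq at hmod
      generalize finrank F H = r at *
      interval_cases r <;> omega
    exact (Submodule.eq_of_le_of_finrank_le hle (hr.trans_le h8)).symm
  · rw [hline] at hx hy
    refine hgr.killingForm_eq_zero_of_mem_iSup_smul h0 (fun c hc ↦ ?_) hx hy
    have hc' : c • α = c.val • α := by
      rw [← Nat.cast_smul_eq_nsmul (ZMod 5), ZMod.natCast_zmod_val]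
    have hlt := c.val_lt
    rw [hc'] at hc
    interval_cases c.val
    · exact hβ (by simpa using hc)
    · exact h1 (by simpa using hc)
    · exact h2 hc
    · exact h3 hc
    · exact h4 hc
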